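/- arXiv:1809.06048 — 2 statements merged into one kernel-verified Lean document; each statement's English description precedes it below -/
import Mathlib

section
/- Let X be a Banach space with the sequential SD2P and N ∈ ℕ. Then the N-fold projective symmetric tensor product ⊗̂_{π,s,N} X has the strong diameter two property; equivalently, the norm of 𝒫(^N X) is octahedral. -/
open Filter Topology

/-- A sequence in a Banach space is equivalent to the canonical basis of `c₀`. -/
def IsEquivC0Basis {X : Type*} [NormedAddCommGroup X] [NormedSpace ℝ X] (x : ℕ → X) : Prop :=
  ∃ a b : ℝ, 0 < a ∧ a ≤ b ∧ ∀ (n : ℕ) (l : Fin n → ℝ),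
    a * (⨆ i, |l i|) ≤ ‖∑ i, l i • x (i : ℕ)‖ ∧
    ‖∑ i, l i • x (i : ℕ)‖ ≤ b * (⨆ i, |l i|)

/-- The sequential strong diameter two property. -/
def SeqSD2P (X : Type*) [NormedAddCommGroup X] [NormedSpace ℝ X] : Prop :=
  ∀ (m : ℕ) (x : Fin m → X), (∀ i, ‖x i‖ = 1) →
    ∃ (y : Fin m → ℕ → X) (z : ℕ → X),
      (∀ i n, ‖y i n‖ = 1) ∧ (∀ n, ‖z n‖ = 1) ∧
      (∀ i, Tendsto (fun n => ‖x i - y i n‖) atTop (𝓝 0) ∨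
        IsEquivC0Basis (fun n => x i - y i n)) ∧
      IsEquivC0Basis z ∧
      (∀ i, Tendsto (fun n => ‖y i n + z n‖) atTop (𝓝 1) ∧
        Tendsto (fun n => ‖y i n - z n‖) atTop (𝓝 1))

/-- `P : X → ℝ` is a continuous `N`-homogeneous polynomial. -/
def IsHomogPoly {X : Type*} [NormedAddCommGroup X] [NormedSpace ℝ X]
    (N : ℕ) (P : X → ℝ) : Prop :=
  ∃ A : ContinuousMultilinearMap ℝ (fun _ : Fin N => X) ℝ, ∀ x, P x = A (fun _ => x)

/-- The norm of a polynomial: its supremum on the closed unit ball. -/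
noncomputable def polyNorm {X : Type*} [NormedAddCommGroup X] [NormedSpace ℝ X]
    (P : X → ℝ) : ℝ :=
  sSup {r : ℝ | ∃ x : X, ‖x‖ ≤ 1 ∧ r = |P x|}

/-- The partial sums of `∑ θ n • v n`, for scalars `|θ n| ≤ 1`, are bounded in norm by `b`. -/
def UnconditionallyBounded {X : Type*} [NormedAddCommGroup X] [NormedSpace ℝ X]
    (b : ℝ) (v : ℕ → X) : Prop :=
  ∀ (S : Finset ℕ) (θ : ℕ → ℝ), (∀ n, |θ n| ≤ 1) → ‖∑ n ∈ S, θ n • v n‖ ≤ b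

section

variable {X : Type*} [NormedAddCommGroup X] [NormedSpace ℝ X]

namespace UnconditionallyBounded

lemma zero : UnconditionallyBounded 0 (fun _ => (0 : X)) := by
  intro S θ _
  simp

lemma nonneg {b : ℝ} {v : ℕ → X} (h : UnconditionallyBounded b v) : 0 ≤ b := by
  simpa using h ∅ (fun _ => 0) (by simp)

lemma add {b b' : ℝ} {v w : ℕ → X} (hv : UnconditionallyBounded b v)
    (hw : UnconditionallyBounded b' w) :
    UnconditionallyBounded (b + b') (fun n => v n + w n) := by
  intro S θ hθ
  simp only [smul_add, Finset.sum_add_distrib]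
  exact (norm_add_le _ _).trans (add_le_add (hv S θ hθ) (hw S θ hθ))

lemma neg {b : ℝ} {v : ℕ → X} (h : UnconditionallyBounded b v) :
    UnconditionallyBounded b (fun n => -v n) := by
  intro S θ hθ
  simpa using h S θ hθ

lemma smul {b : ℝ} {v : ℕ → X} (h : UnconditionallyBounded b v) {θ : ℕ → ℝ}
    (hθ : ∀ n, |θ n| ≤ 1) : UnconditionallyBounded b (fun n => θ n • v n) := by
  intro S η hη
  simp only [smul_smul]
  refine h S _ fun n => ?_
  rw [abs_mul]
  exact mul_le_one₀ (hη n) (abs_nonneg _) (hθ n)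

end UnconditionallyBounded

lemma IsEquivC0Basis.unconditionallyBounded {v : ℕ → X} (h : IsEquivC0Basis v) :
    ∃ b, UnconditionallyBounded b v := by
  classical
  obtain ⟨a, b, ha, hab, H⟩ := h
  refine ⟨b, fun S θ hθ => ?_⟩
  obtain ⟨n, hn⟩ := S.exists_nat_subset_range
  have h2 := (H n fun i => if (i : ℕ) ∈ S then θ i else 0).2
  rw [Fin.sum_univ_eq_sum_range (fun i => (if i ∈ S then θ i else 0) • v i) n] at h2
  have hsum : ∑ i ∈ Finset.range n, (if i ∈ S then θ i else 0) • v i = ∑ n ∈ S, θ n • v n := by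
    rw [← Finset.sum_subset hn]
    · exact Finset.sum_congr rfl fun i hi => by simp [hi]
    · intro i _ hi
      simp [hi]
  rw [hsum] at h2
  refine h2.trans (mul_le_of_le_one_right (ha.le.trans hab) ?_)
  refine Real.iSup_le (fun i => ?_) zero_le_one
  split_ifs
  · exact hθ _
  · simp

/-- The trace of a finite real matrix is dominated by some `∑ εₘ εₙ Mₘₙ` with signs `ε`. -/
lemma exists_signs_trace_le (M : ℕ → ℕ → ℝ) (S : Finset ℕ) :
    ∃ s : ℕ → ℝ, (∀ n, |s n| ≤ 1) ∧
      ∑ n ∈ S, M n n ≤ ∑ m ∈ S, ∑ n ∈ S, s m * s n * M m n := by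
  classical
  induction S using Finset.induction_on with
  | empty => exact ⟨fun _ => 0, by simp, by simp⟩
  | insert a S ha ih =>
    obtain ⟨s, hs, h⟩ := ih
    set R := ∑ n ∈ S, s n * (M a n + M n a) with hR
    obtain ⟨t, ht, htt, htR⟩ : ∃ t : ℝ, |t| ≤ 1 ∧ t * t = 1 ∧ 0 ≤ t * R := by
      rcases le_total 0 R with h0 | h0
      · exact ⟨1, by simp, by simp, by simpa using h0⟩
      · exact ⟨-1, by simp, by simp, by simpa using h0⟩
    refine ⟨Function.update s a t, fun n => ?_, ?_⟩
    · by_cases hn : n = a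
      · subst hn
        simpa using ht
      · simpa [hn] using hs n
    · have hne : ∀ n ∈ S, Function.update s a t n = s n := fun n hn =>
        Function.update_of_ne (by rintro rfl; exact ha hn) _ _
      have h1 : ∑ n ∈ S, t * Function.update s a t n * M a n = ∑ n ∈ S, t * s n * M a n :=
        Finset.sum_congr rfl fun n hn => by rw [hne n hn]
      have h2 : ∑ m ∈ S, (Function.update s a t m * t * M m a +
          ∑ n ∈ S, Function.update s a t m * Function.update s a t n * M m n) =
          ∑ m ∈ S, (s m * t * M m a + ∑ n ∈ S, s m * s n * M m n) :=
        Finset.sum_congr rfl fun m hm => by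
          rw [hne m hm]
          congr 1
          exact Finset.sum_congr rfl fun n hn => by rw [hne n hn]
      have h3 : t * R = ∑ n ∈ S, t * s n * M a n + ∑ n ∈ S, s n * t * M n a := by
        rw [hR, Finset.mul_sum, ← Finset.sum_add_distrib]
        exact Finset.sum_congr rfl fun n _ => by ring
      simp only [Finset.sum_insert ha, Function.update_self]
      rw [h1, h2, Finset.sum_add_distrib, htt]
      linarith

lemma MultilinearMap.sum_apply_le_of_unconditionallyBounded {b : ℝ} (k : ℕ) :
    ∀ (A : MultilinearMap ℝ (fun _ : Fin (k + 1) => X) ℝ) (K : ℝ), 0 ≤ K →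
      (∀ x, |A x| ≤ K * ∏ i, ‖x i‖) →
      ∀ v : Fin (k + 1) → ℕ → X, (∀ i, UnconditionallyBounded b (v i)) →
        ∀ S : Finset ℕ, ∑ n ∈ S, A (fun i => v i n) ≤ K * b ^ (k + 1) := by
  induction k with
  | zero =>
    intro A K hK hA v hv S
    have hsum : ∑ n ∈ S, A (fun i => v i n) = A (fun _ => ∑ n ∈ S, v 0 n) := by
      have hfin : ∀ i : Fin (0 + 1), i = 0 := fun i => Fin.fin_one_eq_zero i
      have h0 : ∀ x : X, (fun _ : Fin (0 + 1) => x) =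
          Function.update (fun _ : Fin (0 + 1) => (0 : X)) 0 x := by
        intro x
        ext i
        rw [hfin i, Function.update_self]
      have h1 : ∀ n, (fun i => v i n) = (fun _ : Fin (0 + 1) => v 0 n) := by
        intro n
        ext i
        rw [hfin i]
      simp only [h1]
      rw [h0, A.map_update_sum]
      exact Finset.sum_congr rfl fun n _ => by rw [← h0]
    rw [hsum]
    refine (le_abs_self _).trans ((hA _).trans ?_)
    have := hv 0 S (fun _ => 1) (by simp)
    simp only [one_smul] at this
    simpa using mul_le_mul_of_nonneg_left this hK
  | succ k ih =>
    intro A K hK hA v hv S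
    have hb : 0 ≤ b := (hv 0).nonneg
    obtain ⟨s, hs, hle⟩ := exists_signs_trace_le
      (fun m n => A (Fin.cons (v 0 m) fun i : Fin (k + 1) => v i.succ n)) S
    set w : Fin (k + 1) → ℕ → X := fun i n => if i = 0 then s n • v i.succ n else v i.succ n
      with hw
    set x : X := ∑ m ∈ S, s m • v 0 m with hx
    have hxb : ‖x‖ ≤ b := hv 0 S s hs
    have hwb : ∀ i, UnconditionallyBounded b (w i) := by
      intro i
      by_cases hi : i = 0
      · simpa [hw, hi] using (hv (Fin.succ 0)).smul hs
      · simpa [hw, hi] using hv i.succ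
    have key := ih (A.curryLeft x) (K * b) (mul_nonneg hK hb) (fun y => by
      rw [MultilinearMap.curryLeft_apply]
      refine (hA _).trans ?_
      rw [Fin.prod_univ_succ]
      simp only [Fin.cons_zero, Fin.cons_succ]
      rw [mul_assoc]
      gcongr) w hwb S
    have hdiag : ∀ n, (fun i => v i n) = Fin.cons (v 0 n) fun i : Fin (k + 1) => v i.succ n := by
      intro n
      ext i
      refine Fin.cases ?_ (fun j => ?_) i <;> simp
    have hcurry : ∀ n, A.curryLeft x (fun i => w i n) =
        ∑ m ∈ S, s m * s n * A (Fin.cons (v 0 m) fun i : Fin (k + 1) => v i.succ n) := by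
      intro n
      have hwn : (fun i => w i n) =
          Function.update (fun i : Fin (k + 1) => v i.succ n) 0 (s n • v (Fin.succ 0) n) := by
        ext i
        by_cases hi : i = 0
        · subst hi
          simp [hw]
        · simp [hw, hi]
      rw [hwn, MultilinearMap.map_update_smul, Function.update_eq_self_iff.2 rfl, hx, _root_.map_sum,
        _root_.sum_apply, Finset.smul_sum]
      refine Finset.sum_congr rfl fun m _ => ?_
      simp only [_root_.map_smul, _root_.smul_apply, MultilinearMap.curryLeft_apply, smul_eq_mul]
      ring
    simp only [hdiag]
    refine hle.trans ?_
    rw [Finset.sum_comm]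
    simp only [hcurry] at key
    refine key.trans (le_of_eq ?_)
    ring

lemma MultilinearMap.tendsto_zero_of_unconditionallyBounded {b : ℝ} {k : ℕ}
    (A : MultilinearMap ℝ (fun _ : Fin (k + 1) => X) ℝ) {K : ℝ} (hK : 0 ≤ K)
    (hA : ∀ x, |A x| ≤ K * ∏ i, ‖x i‖) {v : ℕ → X} (hv : UnconditionallyBounded b v) :
    Tendsto (fun n => A (fun _ => v n)) atTop (𝓝 0) := by
  have hsum : Summable fun n => |A (fun _ => v n)| := by
    refine summable_of_sum_le (c := K * b ^ (k + 1)) (fun _ => abs_nonneg _) fun S => ?_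
    set s : ℕ → ℝ := fun n => SignType.sign (A (fun _ => v n)) with hs
    have hs1 : ∀ n, |s n| ≤ 1 := by
      intro n
      rw [hs]
      rcases lt_trichotomy (A (fun _ => v n)) 0 with h | h | h <;> simp [h]
    have := MultilinearMap.sum_apply_le_of_unconditionallyBounded k A K hK hA
      (fun i n => if i = 0 then s n • v n else v n) (b := b) (fun i => by
        by_cases hi : i = 0
        · simpa [hi] using hv.smul hs1
        · simpa [hi] using hv) S
    refine le_trans (le_of_eq (Finset.sum_congr rfl fun n _ => ?_)) this
    have hupd : (fun i : Fin (k + 1) => if i = 0 then s n • v n else v n) =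
        Function.update (fun _ => v n) 0 (s n • v n) := by
      ext i
      simp [Function.update_apply]
    rw [hupd, MultilinearMap.map_update_smul, Function.update_eq_self_iff.2 rfl, smul_eq_mul, hs]
    exact (sign_mul_self _).symm
  exact (tendsto_zero_iff_abs_tendsto_zero _).2 hsum.tendsto_atTop_zero

namespace IsHomogPoly

variable {N : ℕ} {P Q : X → ℝ}

lemma map_smul (hP : IsHomogPoly N P) (c : ℝ) (x : X) : P (c • x) = c ^ N * P x := by
  obtain ⟨A, hA⟩ := hP
  rw [hA, hA]
  simpa using A.map_smul_univ (fun _ => c) (fun _ => x)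

lemma map_zero (hP : IsHomogPoly N P) (hN : 1 ≤ N) : P 0 = 0 := by
  have := hP.map_smul 0 0
  rwa [zero_pow (by omega), zero_mul, smul_zero] at this

lemma continuous (hP : IsHomogPoly N P) : Continuous P := by
  obtain ⟨A, hA⟩ := hP
  rw [funext hA]
  exact A.cont.comp (continuous_pi fun _ => continuous_id)

lemma exists_bound (hP : IsHomogPoly N P) : ∃ C, ∀ x, ‖x‖ ≤ 1 → |P x| ≤ C := by
  obtain ⟨A, hA⟩ := hP
  refine ⟨‖A‖, fun x hx => ?_⟩
  rw [hA, ← Real.norm_eq_abs]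
  refine (A.le_opNorm _).trans (mul_le_of_le_one_right (norm_nonneg _) ?_)
  exact Finset.prod_le_one (fun _ _ => norm_nonneg _) fun _ _ => hx

lemma sub (hP : IsHomogPoly N P) (hQ : IsHomogPoly N Q) :
    IsHomogPoly N (fun x => P x - Q x) := by
  obtain ⟨A, hA⟩ := hP
  obtain ⟨B, hB⟩ := hQ
  exact ⟨A - B, fun x => by simp [hA, hB]⟩

lemma add (hP : IsHomogPoly N P) (hQ : IsHomogPoly N Q) :
    IsHomogPoly N (fun x => P x + Q x) := by
  obtain ⟨A, hA⟩ := hP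
  obtain ⟨B, hB⟩ := hQ
  exact ⟨A + B, fun x => by simp [hA, hB]⟩

lemma const_mul (hP : IsHomogPoly N P) (c : ℝ) : IsHomogPoly N (fun x => c * P x) := by
  obtain ⟨A, hA⟩ := hP
  exact ⟨c • A, fun x => by simp [hA]⟩

lemma sum {ι : Type*} {P : ι → X → ℝ} (s : Finset ι) (hP : ∀ i, IsHomogPoly N (P i)) :
    IsHomogPoly N (fun x => ∑ i ∈ s, P i x) := by
  choose A hA using hP
  exact ⟨∑ i ∈ s, A i, fun x => by simp [hA]⟩

lemma pow (f : X →L[ℝ] ℝ) (N : ℕ) : IsHomogPoly N (fun x => f x ^ N) :=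
  ⟨(ContinuousMultilinearMap.mkPiAlgebra ℝ (Fin N) ℝ).compContinuousLinearMap (fun _ => f),
    fun x => by simp⟩

/-- Continuous polynomials are sequentially continuous along unconditionally bounded
perturbations. -/
lemma tendsto_add (hP : IsHomogPoly N P) (x : X) {b : ℝ} {v : ℕ → X}
    (hv : UnconditionallyBounded b v) : Tendsto (fun n => P (x + v n)) atTop (𝓝 (P x)) := by
  classical
  obtain ⟨A, hA⟩ := hP
  have hexp : ∀ n, P (x + v n) =
      ∑ s : Finset (Fin N), A (s.piecewise (fun _ => v n) (fun _ => x)) := by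
    intro n
    rw [hA, add_comm]
    exact A.toMultilinearMap.map_add_univ (fun _ => v n) (fun _ => x)
  have hlim : ∀ s : Finset (Fin N),
      Tendsto (fun n => A (s.piecewise (fun _ => v n) (fun _ => x))) atTop
        (𝓝 (if s = ∅ then P x else 0)) := by
    intro s
    rcases s.eq_empty_or_nonempty with rfl | hs
    · simp [hA]
    · rw [if_neg hs.ne_empty]
      obtain ⟨k, hk⟩ := Nat.exists_eq_succ_of_ne_zero hs.card_pos.ne'
      set B := A.toMultilinearMap.restr s hk x with hB
      have hbound : ∀ y, |B y| ≤ ‖A‖ * ‖x‖ ^ (N - (k + 1)) * ∏ i, ‖y i‖ := fun y =>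
        MultilinearMap.restr_norm_le A.toMultilinearMap s hk x A.le_opNorm y
      have := B.tendsto_zero_of_unconditionallyBounded (by positivity) hbound hv
      refine this.congr fun n => ?_
      rw [hB, MultilinearMap.restr]
      simp only [MultilinearMap.coe_mk]
      congr 1
  have := tendsto_finsetSum Finset.univ fun s (_ : s ∈ Finset.univ) => hlim s
  simp only [Finset.sum_ite_eq', Finset.mem_univ, if_true] at this
  exact this.congr fun n => (hexp n).symm

lemma bddAbove (hP : IsHomogPoly N P) :
    BddAbove {r : ℝ | ∃ x : X, ‖x‖ ≤ 1 ∧ r = |P x|} := by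
  obtain ⟨C, hC⟩ := hP.exists_bound
  refine ⟨C, ?_⟩
  rintro _ ⟨x, hx, rfl⟩
  exact hC x hx

lemma abs_le_polyNorm (hP : IsHomogPoly N P) {x : X} (hx : ‖x‖ ≤ 1) : |P x| ≤ polyNorm P :=
  le_csSup hP.bddAbove ⟨x, hx, rfl⟩

/-- The restriction of a continuous homogeneous polynomial to the closed unit ball. -/
noncomputable def toBCF (hP : IsHomogPoly N P) :
    BoundedContinuousFunction (Metric.closedBall (0 : X) 1) ℝ :=
  BoundedContinuousFunction.ofNormedAddCommGroup (fun x => P x)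
    (hP.continuous.comp continuous_subtype_val) hP.exists_bound.choose
    fun x => hP.exists_bound.choose_spec x (mem_closedBall_zero_iff.1 x.2)

@[simp] lemma toBCF_apply (hP : IsHomogPoly N P) (x : Metric.closedBall (0 : X) 1) :
    hP.toBCF x = P x := rfl

end IsHomogPoly

lemma polyNorm_le {P : X → ℝ} {C : ℝ} (h : ∀ x, ‖x‖ ≤ 1 → |P x| ≤ C) : polyNorm P ≤ C := by
  refine csSup_le ⟨_, 0, by simp, rfl⟩ ?_
  rintro _ ⟨x, hx, rfl⟩
  exact h x hx

lemma polyNorm_nonneg (P : X → ℝ) : 0 ≤ polyNorm P := by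
  refine Real.sSup_nonneg ?_
  rintro _ ⟨x, _, rfl⟩
  exact abs_nonneg _

lemma polyNorm_const_mul {N : ℕ} {P : X → ℝ} (hP : IsHomogPoly N P) {c : ℝ} (hc : 0 < c) :
    polyNorm (fun x => c * P x) = c * polyNorm P := by
  refine le_antisymm (polyNorm_le fun x hx => ?_) ?_
  · rw [abs_mul, abs_of_pos hc]
    exact mul_le_mul_of_nonneg_left (hP.abs_le_polyNorm hx) hc.le
  · rw [mul_comm, ← le_div_iff₀ hc]
    refine polyNorm_le fun x hx => ?_
    rw [le_div_iff₀ hc, mul_comm]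
    simpa [abs_mul, abs_of_pos hc] using (hP.const_mul c).abs_le_polyNorm hx

lemma IsHomogPoly.norm_toBCF {N : ℕ} {P : X → ℝ} (hP : IsHomogPoly N P) :
    ‖hP.toBCF‖ = polyNorm P := by
  refine le_antisymm ?_ ?_
  · refine (BoundedContinuousFunction.norm_le (polyNorm_nonneg P)).2 fun x => ?_
    exact hP.abs_le_polyNorm (mem_closedBall_zero_iff.1 x.2)
  · exact polyNorm_le fun x hx => hP.toBCF.norm_coe_le_norm ⟨x, mem_closedBall_zero_iff.2 hx⟩

lemma IsHomogPoly.exists_norm_one_polyNorm_sub_le {N : ℕ} (hN : 1 ≤ N) {P : X → ℝ}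
    (hP : IsHomogPoly N P) {e : X} (he : ‖e‖ = 1) {δ : ℝ} (hδ : 0 < δ) :
    ∃ x : X, ‖x‖ = 1 ∧ polyNorm P - δ ≤ |P x| := by
  obtain ⟨_, ⟨x, hx, rfl⟩, hlt⟩ := exists_lt_of_lt_csSup
    (s := {r : ℝ | ∃ x : X, ‖x‖ ≤ 1 ∧ r = |P x|}) ⟨_, 0, by simp, rfl⟩ (sub_lt_self (polyNorm P) hδ)
  rcases eq_or_ne x 0 with rfl | hx0
  · refine ⟨e, he, ?_⟩
    rw [hP.map_zero hN, abs_zero] at hlt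
    exact hlt.le.trans (abs_nonneg _)
  · refine ⟨‖x‖⁻¹ • x, norm_smul_inv_norm hx0, ?_⟩
    have h1 : 1 ≤ ‖x‖⁻¹ := (one_le_inv₀ (norm_pos_iff.2 hx0)).2 hx
    rw [hP.map_smul, abs_mul, abs_of_nonneg (by positivity)]
    exact hlt.le.trans (le_mul_of_one_le_left (abs_nonneg _) (one_le_pow₀ h1))

lemma SeqSD2P.exists_norm_one (hX : SeqSD2P X) : ∃ e : X, ‖e‖ = 1 := by
  obtain ⟨_, z, _, hz, _⟩ := hX 0 (fun _ => 0) (fun i => i.elim0)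
  exact ⟨z 0, hz 0⟩

lemma SeqSD2P.exists_unconditionallyBounded (hX : SeqSD2P X) {ι : Type*} [Finite ι]
    (x : ι → X) (hx : ∀ i, ‖x i‖ = 1) :
    ∃ (y : ι → ℕ → X) (z : ℕ → X),
      (∀ i n, ‖y i n‖ = 1) ∧ (∀ n, ‖z n‖ = 1) ∧
      (∀ i, ∃ b, UnconditionallyBounded b (fun n => y i n - x i)) ∧
      (∃ b, UnconditionallyBounded b z) ∧
      (∀ i, Tendsto (fun n => ‖y i n + z n‖) atTop (𝓝 1) ∧
        Tendsto (fun n => ‖y i n - z n‖) atTop (𝓝 1)) := by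
  obtain ⟨m, ⟨e⟩⟩ := Finite.exists_equiv_fin ι
  obtain ⟨y, z, hy, hz, hyx, hzc, hyz⟩ := hX m (fun j => x (e.symm j)) (fun j => hx _)
  suffices H : ∀ i, ∃ y' : ℕ → X, (∀ n, ‖y' n‖ = 1) ∧
      (∃ b, UnconditionallyBounded b (fun n => y' n - x i)) ∧
      Tendsto (fun n => ‖y' n + z n‖) atTop (𝓝 1) ∧
      Tendsto (fun n => ‖y' n - z n‖) atTop (𝓝 1) by
    choose y' h1 h2 h3 using H
    exact ⟨y', z, h1, hz, h2, hzc.unconditionallyBounded, h3⟩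
  intro i
  have hi := hyx (e i)
  simp only [Equiv.symm_apply_apply] at hi
  rcases hi with hi | hi
  · have aux : ∀ w : ℕ → X, Tendsto (fun n => ‖y (e i) n + w n‖) atTop (𝓝 1) →
        Tendsto (fun n => ‖x i + w n‖) atTop (𝓝 1) := by
      intro w hw
      refine tendsto_of_tendsto_of_dist hw (squeeze_zero (fun _ => dist_nonneg) (fun n => ?_) hi)
      rw [Real.dist_eq, abs_sub_comm]
      refine (abs_norm_sub_norm_le _ _).trans (le_of_eq ?_)
      congr 1
      abel
    refine ⟨fun _ => x i, fun _ => hx i, ⟨0, ?_⟩, aux z (hyz (e i)).1, ?_⟩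
    · simpa using UnconditionallyBounded.zero (X := X)
    · simpa [sub_eq_add_neg] using
        aux (fun n => -z n) (by simpa [sub_eq_add_neg] using (hyz (e i)).2)
  · obtain ⟨b, hb⟩ := hi.unconditionallyBounded
    exact ⟨y (e i), hy _, ⟨b, by simpa using hb.neg⟩, hyz _⟩

lemma SeqSD2P.exists_norming_functionals (hX : SeqSD2P X) {ι : Type*} [Finite ι]
    (x : ι → X) (hx : ∀ i, ‖x i‖ = 1) :
    ∃ (y u : ι → ℕ → X) (f : ℕ → X →L[ℝ] ℝ),
      (∀ i n, ‖y i n‖ = 1) ∧ (∀ i n, ‖u i n‖ ≤ 1) ∧ (∀ i, ∀ᶠ n in atTop, ‖u i n‖ = 1) ∧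
      (∀ n, ‖f n‖ ≤ 1) ∧
      (∀ i, Tendsto (fun n => f n (y i n)) atTop (𝓝 0)) ∧
      (∀ i, Tendsto (fun n => f n (u i n)) atTop (𝓝 1)) ∧
      ∀ (N : ℕ) (P : X → ℝ), IsHomogPoly N P → ∀ i,
        Tendsto (fun n => P (y i n)) atTop (𝓝 (P (x i))) ∧
        Tendsto (fun n => P (u i n)) atTop (𝓝 (P (x i))) := by
  obtain ⟨y, z, hy, hz, hyx, ⟨bz, hbz⟩, hyz⟩ := hX.exists_unconditionallyBounded x hx
  have hf : ∀ n, ∃ f : X →L[ℝ] ℝ, ‖f‖ = 1 ∧ f (z n) = 1 := by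
    intro n
    obtain ⟨f, hf, hfz⟩ := exists_dual_vector ℝ (z n) (by rw [← norm_ne_zero_iff, hz]; simp)
    exact ⟨f, hf, by simpa [hz] using hfz⟩
  choose f hf1 hfz using hf
  have hinv : ∀ i, Tendsto (fun n => ‖y i n + z n‖⁻¹) atTop (𝓝 1) := fun i => by
    simpa using (hyz i).1.inv₀ one_ne_zero
  have hfle : ∀ n w, f n w ≤ ‖w‖ := fun n w => by
    simpa [hf1] using (le_abs_self _).trans ((f n).le_opNorm w)
  have hfy : ∀ i, Tendsto (fun n => f n (y i n)) atTop (𝓝 0) := by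
    intro i
    refine tendsto_of_tendsto_of_tendsto_of_le_of_le (g := fun n => 1 - ‖y i n - z n‖)
      (h := fun n => ‖y i n + z n‖ - 1) (by simpa using (hyz i).2.const_sub 1)
      (by simpa using (hyz i).1.sub_const 1) (fun n => ?_) (fun n => ?_)
    · have := hfle n (z n - y i n)
      rw [map_sub, hfz, norm_sub_rev] at this
      dsimp only
      linarith
    · have := hfle n (y i n + z n)
      rw [map_add, hfz] at this
      dsimp only
      linarith
  refine ⟨y, fun i n => ‖y i n + z n‖⁻¹ • (y i n + z n), f, hy, fun i n => ?_, fun i => ?_,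
    fun n => (hf1 n).le, hfy, fun i => ?_, fun N P hP i => ⟨?_, ?_⟩⟩
  · rw [norm_smul, norm_inv, norm_norm]
    exact inv_mul_le_one
  · filter_upwards [(hyz i).1.eventually_ne one_ne_zero] with n hn
    rw [norm_smul, norm_inv, norm_norm, inv_mul_cancel₀ hn]
  · simpa [hfz, mul_add] using (hinv i).mul ((hfy i).add_const 1)
  · obtain ⟨b, hb⟩ := hyx i
    simpa using hP.tendsto_add (x i) hb
  · obtain ⟨b, hb⟩ := hyx i
    have h1 : Tendsto (fun n => P (y i n + z n)) atTop (𝓝 (P (x i))) := by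
      refine (hP.tendsto_add (x i) (hb.add hbz)).congr fun n => ?_
      congr 1
      abel
    simp only [hP.map_smul]
    simpa using ((hinv i).pow N).mul h1

lemma ContinuousLinearMap.abs_apply_le_one {f : X →L[ℝ] ℝ} (hf : ‖f‖ ≤ 1) {x : X}
    (hx : ‖x‖ ≤ 1) : |f x| ≤ 1 :=
  (f.le_opNorm x).trans (mul_le_one₀ hf (norm_nonneg _) hx)

lemma Submodule.exists_finite_net_unitBall {E : Type*} [NormedAddCommGroup E] [NormedSpace ℝ E]
    (F : Submodule ℝ E) [FiniteDimensional ℝ F] {δ : ℝ} (hδ : 0 < δ) :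
    ∃ t : Set F, t.Finite ∧ t.Nonempty ∧
      ∀ g ∈ F, ‖g‖ ≤ 1 → ∃ h ∈ t, ‖g - (h : E)‖ < δ := by
  have : ProperSpace F := FiniteDimensional.proper ℝ F
  obtain ⟨t, -, htfin, hcover⟩ := (isCompact_closedBall (0 : F) 1).finite_cover_balls hδ
  have key : ∀ g ∈ F, ‖g‖ ≤ 1 → ∃ h ∈ t, ‖g - (h : E)‖ < δ := by
    intro g hg hg1
    have hgc := hcover (a := (⟨g, hg⟩ : F)) (mem_closedBall_zero_iff.2 hg1)
    simp only [Set.mem_iUnion] at hgc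
    obtain ⟨h, ht, hgh⟩ := hgc
    exact ⟨h, ht, mem_ball_iff_norm.1 hgh⟩
  obtain ⟨h, ht, -⟩ := key 0 F.zero_mem (by simp)
  exact ⟨t, htfin, ⟨h, ht⟩, key⟩

lemma SeqSD2P.exists_poly_of_odd (hX : SeqSD2P X) {N : ℕ} (hN : Odd N) {ι : Type*} [Finite ι]
    (P : ι → X → ℝ) (hP : ∀ i, IsHomogPoly N (P i)) (x : ι → X) (hx : ∀ i, ‖x i‖ = 1)
    {δ : ℝ} (hδ : 0 < δ) :
    ∃ Q : X → ℝ, IsHomogPoly N Q ∧ (∀ w, ‖w‖ ≤ 1 → |Q w| ≤ 1) ∧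
      ∀ i, ∃ w, ‖w‖ ≤ 1 ∧ |P i (x i)| - δ ≤ P i w ∧ 1 - δ ≤ Q w := by
  have hx' : ∀ i, ∃ x' : X, ‖x'‖ = 1 ∧ P i x' = |P i (x i)| := by
    intro i
    rcases le_total 0 (P i (x i)) with h | h
    · exact ⟨x i, hx i, (abs_of_nonneg h).symm⟩
    · refine ⟨-x i, by rw [norm_neg, hx], ?_⟩
      have := (hP i).map_smul (-1) (x i)
      rw [hN.neg_one_pow] at this
      simpa [abs_of_nonpos h] using this
  choose x' hx'1 hx'P using hx'
  obtain ⟨y, u, f, hy, hu, hu1, hf, hfy, hfu, hlim⟩ := hX.exists_norming_functionals x' hx'1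
  have hev : ∀ᶠ n in atTop, ∀ i, |P i (x i)| - δ < P i (u i n) ∧ 1 - δ < f n (u i n) ^ N := by
    refine eventually_all.2 fun i => ?_
    have h1 := (hlim N (P i) (hP i) i).2
    rw [hx'P] at h1
    have h2 := (hfu i).pow N
    rw [one_pow] at h2
    exact (h1.eventually_const_lt (by linarith)).and (h2.eventually_const_lt (by linarith))
  obtain ⟨n, hn⟩ := hev.exists
  refine ⟨fun w => f n w ^ N, .pow (f n) N, fun w hw => ?_,
    fun i => ⟨u i n, hu i n, (hn i).1.le, (hn i).2.le⟩⟩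
  rw [abs_pow]
  exact pow_le_one₀ (abs_nonneg _) (ContinuousLinearMap.abs_apply_le_one (hf n) hw)

lemma SeqSD2P.exists_poly_of_even (hX : SeqSD2P X) {N : ℕ} (hN : Even N) (hN0 : N ≠ 0)
    {ι : Type*} [Finite ι]
    (P : ι → X → ℝ) (hP : ∀ i, IsHomogPoly N (P i)) (x : ι → X) (hx : ∀ i, ‖x i‖ = 1)
    {δ : ℝ} (hδ : 0 < δ) :
    ∃ Q : X → ℝ, IsHomogPoly N Q ∧ (∀ w, ‖w‖ ≤ 1 → |Q w| ≤ 1) ∧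
      ∀ i, ∃ w, ‖w‖ ≤ 1 ∧ ((|P i (x i)| - δ ≤ P i w ∧ 1 - δ ≤ Q w) ∨
        (|P i (x i)| - δ ≤ -P i w ∧ 1 - δ ≤ -Q w)) := by
  obtain ⟨y, u, f, hy, hu, hu1, hf, hfy, hfu, hlim⟩ := hX.exists_norming_functionals x hx
  have hev : ∀ᶠ n in atTop, ∀ i, ‖u i n‖ = 1 ∧
      |P i (y i n) - P i (x i)| < δ / 2 ∧ |P i (u i n) - P i (x i)| < δ / 2 ∧
      f n (y i n) ^ N < δ / 2 ∧ 1 - δ / 2 < f n (u i n) ^ N := by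
    refine eventually_all.2 fun i => ?_
    have hPi := hlim N (P i) (hP i) i
    have h1 := (hfy i).pow N
    rw [zero_pow hN0] at h1
    have h2 := (hfu i).pow N
    rw [one_pow] at h2
    have hd := half_pos hδ
    exact (hu1 i).and ((Metric.tendsto_nhds.1 hPi.1 _ hd).and ((Metric.tendsto_nhds.1 hPi.2 _ hd).and
      ((h1.eventually_lt_const hd).and (h2.eventually_const_lt (by linarith)))))
  obtain ⟨n, hn⟩ := hev.exists
  choose hun hPy hPu hfyn hfun using hn
  obtain ⟨y', u', g, hy', hu', hu1', hg, hgy, hgu, hlim'⟩ := hX.exists_norming_functionals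
    (Sum.elim (fun i => y i n) (fun i => u i n)) (by rintro (i | i) <;> simp [hy, hun])
  have hev' : ∀ᶠ k in atTop, ∀ i,
      (|P i (u' (.inl i) k) - P i (y i n)| < δ / 2 ∧ |P i (y' (.inr i) k) - P i (u i n)| < δ / 2) ∧
      1 - δ < f n (y' (.inr i) k) ^ N - g k (y' (.inr i) k) ^ N ∧
      f n (u' (.inl i) k) ^ N - g k (u' (.inl i) k) ^ N < -(1 - δ) := by
    refine eventually_all.2 fun i => ?_
    have hd := half_pos hδ
    have hP1 := (hlim' N (P i) (hP i) (.inl i)).2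
    have hP2 := (hlim' N (P i) (hP i) (.inr i)).1
    have hf1 := (hlim' N _ (.pow (f n) N) (.inl i)).2.sub ((hgu (.inl i)).pow N)
    have hf2 := (hlim' N _ (.pow (f n) N) (.inr i)).1.sub ((hgy (.inr i)).pow N)
    simp only [Sum.elim_inl, Sum.elim_inr, one_pow, zero_pow hN0] at hP1 hP2 hf1 hf2
    refine ((Metric.tendsto_nhds.1 hP1 _ hd).and (Metric.tendsto_nhds.1 hP2 _ hd)).and
      ((hf2.eventually_const_lt ?_).and (hf1.eventually_lt_const ?_))
    · linarith [hfun i]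
    · linarith [hfyn i]
  obtain ⟨k, hk⟩ := hev'.exists
  refine ⟨fun w => f n w ^ N - g k w ^ N, (IsHomogPoly.pow (f n) N).sub (.pow (g k) N),
    fun w hw => ?_, fun i => ?_⟩
  · have hpow : ∀ h : X →L[ℝ] ℝ, ‖h‖ ≤ 1 → 0 ≤ h w ^ N ∧ h w ^ N ≤ 1 := fun h hh =>
      ⟨hN.pow_nonneg _, by
        rw [← hN.pow_abs]
        exact pow_le_one₀ (abs_nonneg _) (ContinuousLinearMap.abs_apply_le_one hh hw)⟩
    have h1 := hpow _ (hf n)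
    have h2 := hpow _ (hg k)
    rw [abs_le]
    constructor <;> linarith
  · obtain ⟨⟨h1, h2⟩, h3, h4⟩ := hk i
    have h5 := hPy i
    have h6 := hPu i
    rw [abs_lt] at h1 h2 h5 h6
    rcases le_total 0 (P i (x i)) with h | h
    · refine ⟨y' (.inr i) k, (hy' _ _).le, .inl ⟨?_, h3.le⟩⟩
      rw [abs_of_nonneg h]
      linarith
    · refine ⟨u' (.inl i) k, hu' _ _, .inr ⟨?_, by linarith⟩⟩
      rw [abs_of_nonpos h]
      linarith

/-- Given finitely many polynomials and unit vectors, there is a norm-one polynomial almost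
attaining its norm, with the right sign, where the given polynomials almost attain the absolute
values they take at the given vectors. -/
lemma SeqSD2P.exists_poly (hX : SeqSD2P X) {N : ℕ} (hN : 1 ≤ N) {ι : Type*} [Finite ι]
    [Nonempty ι] (P : ι → X → ℝ) (hP : ∀ i, IsHomogPoly N (P i)) (x : ι → X)
    (hx : ∀ i, ‖x i‖ = 1) {δ : ℝ} (hδ : 0 < δ) (hδ1 : δ < 1) :
    ∃ Q : X → ℝ, IsHomogPoly N Q ∧ polyNorm Q = 1 ∧
      ∀ i, ∃ w, ‖w‖ ≤ 1 ∧ ((|P i (x i)| - δ ≤ P i w ∧ 1 - δ ≤ Q w) ∨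
        (|P i (x i)| - δ ≤ -P i w ∧ 1 - δ ≤ -Q w)) := by
  obtain ⟨Q, hQ, hQ1, hw⟩ : ∃ Q : X → ℝ, IsHomogPoly N Q ∧ (∀ w, ‖w‖ ≤ 1 → |Q w| ≤ 1) ∧
      ∀ i, ∃ w, ‖w‖ ≤ 1 ∧ ((|P i (x i)| - δ ≤ P i w ∧ 1 - δ ≤ Q w) ∨
        (|P i (x i)| - δ ≤ -P i w ∧ 1 - δ ≤ -Q w)) := by
    rcases N.even_or_odd with h | h
    · exact hX.exists_poly_of_even h (by omega) P hP x hx hδ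
    · obtain ⟨Q, hQ, hQ1, hw⟩ := hX.exists_poly_of_odd h P hP x hx hδ
      refine ⟨Q, hQ, hQ1, fun i => ?_⟩
      obtain ⟨w, h1, h2⟩ := hw i
      exact ⟨w, h1, .inl h2⟩
  have hle : polyNorm Q ≤ 1 := polyNorm_le hQ1
  have hpos : 0 < polyNorm Q := by
    obtain ⟨w, h1, h2⟩ := hw (Classical.arbitrary ι)
    refine lt_of_lt_of_le ?_ (hQ.abs_le_polyNorm h1)
    rw [abs_pos]
    intro h0
    rw [h0] at h2
    rcases h2 with ⟨-, h⟩ | ⟨-, h⟩ <;> linarith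
  have hinv : 1 ≤ (polyNorm Q)⁻¹ := (one_le_inv₀ hpos).2 hle
  have hscale : ∀ t : ℝ, 1 - δ ≤ t → 1 - δ ≤ (polyNorm Q)⁻¹ * t := fun t ht =>
    ht.trans (le_mul_of_one_le_left (by linarith) hinv)
  refine ⟨fun w => (polyNorm Q)⁻¹ * Q w, hQ.const_mul _, ?_, fun i => ?_⟩
  · rw [polyNorm_const_mul hQ (inv_pos.2 hpos), inv_mul_cancel₀ hpos.ne']
  · obtain ⟨w, h1, h2⟩ := hw i
    refine ⟨w, h1, h2.imp (fun h => ⟨h.1, hscale _ h.2⟩) (fun h => ⟨h.1, ?_⟩)⟩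
    rw [← mul_neg]
    exact hscale _ h.2

end

/-- Corollary 2.5(1): if `X` has the sequential SD2P then `⊗̂_{π,s,N} X` has the SD2P;
equivalently the norm of `𝒫(^N X)` is octahedral. Octahedrality is stated via finitely
many spanning polynomials: for all `P₁,…,P_m ∈ 𝒫(^N X)` and `ε > 0` there is a norm-one
`Q ∈ 𝒫(^N X)` with `‖P + λQ‖ ≥ (1−ε)(‖P‖ + |λ|)` for all `P ∈ span{P₁,…,P_m}`, `λ ∈ ℝ`. -/
theorem stmt11 {X : Type*} [NormedAddCommGroup X] [NormedSpace ℝ X] [CompleteSpace X]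
    (hX : SeqSD2P X) (N : ℕ) (hN : 1 ≤ N) :
    ∀ (m : ℕ) (P : Fin m → X → ℝ), (∀ i, IsHomogPoly N (P i)) →
      ∀ ε : ℝ, 0 < ε →
        ∃ Q : X → ℝ, IsHomogPoly N Q ∧ polyNorm Q = 1 ∧
          ∀ (c : Fin m → ℝ) (lam : ℝ),
            polyNorm (fun x => (∑ i, c i * P i x) + lam * Q x) ≥
              (1 - ε) * (polyNorm (fun x => ∑ i, c i * P i x) + |lam|) := by
  classical
  intro m P hP ε hε
  obtain ⟨e, he⟩ := hX.exists_norm_one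
  set δ := min (ε / 4) (1 / 2) with hδdef
  have hδ : 0 < δ := by positivity
  have hδε : 4 * δ ≤ ε := by linarith [min_le_left (ε / 4) (1 / 2)]
  have hδ1 : δ < 1 := (min_le_right _ _).trans_lt (by norm_num)
  set p := fun i => (hP i).toBCF with hp
  set F := Submodule.span ℝ (Set.range p) with hF
  have : FiniteDimensional ℝ F := FiniteDimensional.span_of_finite ℝ (Set.finite_range p)
  have hcomb : ∀ c : Fin m → ℝ, IsHomogPoly N (fun x => ∑ i, c i * P i x) := fun c =>
    .sum _ fun i => (hP i).const_mul (c i)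
  have hcombF : ∀ c : Fin m → ℝ, (hcomb c).toBCF = ∑ i, c i • p i := by
    intro c
    ext x
    simp [hp, BoundedContinuousFunction.sum_apply]
  obtain ⟨t, htfin, htne, hcover⟩ := F.exists_finite_net_unitBall hδ
  have : Finite t := htfin
  have : Nonempty t := htne.to_subtype
  have hcoeff : ∀ h : F, ∃ c : Fin m → ℝ, (hcomb c).toBCF = h := by
    intro h
    obtain ⟨c, hc⟩ := (Submodule.mem_span_range_iff_exists_fun ℝ).1 h.2
    exact ⟨c, by rw [hcombF, hc]⟩
  choose c hc using hcoeff
  choose x hx1 hx using fun h : t =>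
    (hcomb (c h)).exists_norm_one_polyNorm_sub_le hN he hδ
  obtain ⟨Q, hQ, hQ1, hw⟩ := hX.exists_poly hN (fun h : t => fun x => ∑ i, c h i * P i x)
    (fun h => hcomb (c h)) x hx1 hδ hδ1
  have main : ∀ (d : Fin m → ℝ) (lam : ℝ), 0 ≤ lam →
      (1 - ε) * (polyNorm (fun x => ∑ i, d i * P i x) + lam) ≤
        polyNorm (fun x => (∑ i, d i * P i x) + lam * Q x) := by
    intro d lam hlam
    set r := polyNorm (fun x => ∑ i, d i * P i x) with hr
    have hr0 : 0 ≤ r := polyNorm_nonneg _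
    have hGr : ‖(hcomb d).toBCF‖ = r := (hcomb d).norm_toBCF
    set g := r⁻¹ • (hcomb d).toBCF with hg
    have hgF : g ∈ F := by
      rw [hg, hcombF]
      exact Submodule.smul_mem _ _ (Submodule.sum_mem _ fun i _ =>
        Submodule.smul_mem _ _ (Submodule.subset_span ⟨i, rfl⟩))
    have hgnorm : ‖g‖ = r⁻¹ * r := by
      rw [hg, norm_smul, hGr, norm_inv, Real.norm_of_nonneg hr0]
    have hrg : r * ‖g‖ = r := by
      rw [hgnorm, ← mul_assoc, mul_inv_mul_cancel]
    obtain ⟨h, ht, hgh⟩ := hcover g hgF (hgnorm.trans_le inv_mul_le_one)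
    obtain ⟨w, hw1, hwh⟩ := hw ⟨h, ht⟩
    have hxh := hx ⟨h, ht⟩
    rw [← (hcomb (c h)).norm_toBCF, hc] at hxh
    have hgn := norm_sub_norm_le g h
    have hGw : (∑ i, d i * P i w) = r * g ⟨w, mem_closedBall_zero_iff.2 hw1⟩ := by
      have h1 : r * (r⁻¹ * ∑ i, d i * P i w) = ∑ i, d i * P i w := by
        rcases eq_or_ne r 0 with h0 | h0
        · have := (hcomb d).abs_le_polyNorm hw1
          rw [← hr, h0, abs_nonpos_iff] at this
          rw [this]
          simp
        · rw [mul_inv_cancel_left₀ h0]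
      rw [hg]
      simpa using h1.symm
    have hdiff : |g ⟨w, mem_closedBall_zero_iff.2 hw1⟩ - ∑ i, c h i * P i w| ≤ δ := by
      have := (g - h).norm_coe_le_norm ⟨w, mem_closedBall_zero_iff.2 hw1⟩
      rw [← hc h] at this hgh
      exact this.trans hgh.le
    rw [abs_le] at hdiff
    refine le_trans ?_ (((hcomb d).add (hQ.const_mul lam)).abs_le_polyNorm hw1)
    rw [hGw]
    dsimp only at hwh hxh
    have hfinal : ∀ a q : ℝ, ‖g‖ - 4 * δ ≤ a → 1 - δ ≤ q →
        (1 - ε) * (r + lam) ≤ r * a + lam * q := by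
      intro a q ha hq
      have h1 := mul_le_mul_of_nonneg_left ha hr0
      have h2 := mul_le_mul_of_nonneg_left hq hlam
      have h3 := mul_le_mul_of_nonneg_left hδε hr0
      have h4 : lam * δ ≤ lam * ε := mul_le_mul_of_nonneg_left (by linarith) hlam
      rw [mul_sub, hrg] at h1
      linarith
    rcases hwh with ⟨h1, h2⟩ | ⟨h1, h2⟩
    · exact (hfinal _ _ (by linarith) h2).trans (le_abs_self _)
    · refine (hfinal (-g ⟨w, mem_closedBall_zero_iff.2 hw1⟩) _ (by linarith) h2).trans
        (le_trans (le_of_eq ?_) (neg_le_abs _))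
      ring
  refine ⟨Q, hQ, hQ1, fun d lam => ?_⟩
  rcases le_total 0 lam with h | h
  · rw [abs_of_nonneg h]
    exact main d lam h
  · have := main (-d) (-lam) (by linarith)
    have habs : ∀ R : X → ℝ, polyNorm (fun x => -R x) = polyNorm R := fun R => by
      simp only [polyNorm, abs_neg]
    have e1 : (fun x => ∑ i, (-d) i * P i x) = fun x => -∑ i, d i * P i x := by
      ext x
      simp
    have e2 : (fun x => (∑ i, (-d) i * P i x) + -lam * Q x) =
        fun x => -((∑ i, d i * P i x) + lam * Q x) := by
      ext x
      simp
      ring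
    rw [e1, e2, habs, habs] at this
    rw [abs_of_nonpos h]
    exact this
end

section
/- Let X be a Banach space whose unit ball has an extreme point p and assume there exists a sequence (fₙ) of norm-one elements of the centralizer construction as in the proof of Lemma 2.2 of [abr]; concretely, assume there exists a sequence (fₙ) in B_X equivalent to the c₀ basis with ‖fₙ‖ = 1 such that for any x ∈ S_X, setting yₙ := x − fₙ·x appropriately one has ‖yₙ ± fₙ p‖ → 1. Simplified verifiable statement: if X = C(K) for K compact Hausdorff with infinitely many points and K has a sequence of pairwise disjoint nonempty open sets Vₙ with points tₙ ∈ Vₙ, then for any x₁,…,x_m ∈ S_{C(K)} there exist sequences (yₙⁱ), (zₙ) in S_{C(K)} with (xᵢ − yₙⁱ) either norm-null or c₀-basis-equivalent, (zₙ) c₀-basis-equivalent, and ‖yₙⁱ ± zₙ‖ → 1; i.e., C(K) has the sequential SD2P whenever K is infinite. -/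
open Filter Topology

/-- A bounded, disjointly supported sequence in `C(K, ℝ)` that is bounded away from zero is
equivalent to the canonical basis of `c₀`. -/
theorem isEquivC0Basis_of_disjoint_support {K : Type*} [TopologicalSpace K] [CompactSpace K]
    (g : ℕ → C(K, ℝ)) (hdisj : ∀ n m, n ≠ m → ∀ s, g n s = 0 ∨ g m s = 0)
    (hle : ∀ n s, |g n s| ≤ 1) (u : ℕ → K) {c : ℝ} (hc : 0 < c) (hu : ∀ n, c ≤ |g n (u n)|) :
    IsEquivC0Basis g := by
  have heval : ∀ (n : ℕ) (l : Fin n → ℝ) (j : Fin n) (s : K), g j s ≠ 0 →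
      (∑ i, l i • g (i : ℕ)) s = l j * g j s := by
    intro n l j s hj
    rw [ContinuousMap.sum_apply, Finset.sum_eq_single j]
    · simp
    · intro i _ hij
      have h := (hdisj i j (fun h => hij (Fin.ext h)) s).resolve_right hj
      simp [h]
    · simp
  refine ⟨c, 1, hc, (hu 0).trans (hle 0 _), fun n l => ⟨?_, ?_⟩⟩
  · rw [Real.mul_iSup_of_nonneg hc.le]
    refine Real.iSup_le (fun j => ?_) (norm_nonneg _)
    have hne : g j (u j) ≠ 0 := abs_pos.1 (hc.trans_le (hu j))
    calc c * |l j| ≤ |l j| * |g j (u j)| := by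
          rw [mul_comm]; exact mul_le_mul_of_nonneg_left (hu j) (abs_nonneg _)
      _ = ‖(∑ i, l i • g (i : ℕ)) (u j)‖ := by
          rw [heval n l j _ hne, Real.norm_eq_abs, abs_mul]
      _ ≤ _ := ContinuousMap.norm_coe_le_norm _ _
  · have hnn : 0 ≤ ⨆ i, |l i| := Real.iSup_nonneg fun i => abs_nonneg _
    rw [one_mul, ContinuousMap.norm_le _ hnn]
    intro s
    by_cases h : ∃ j : Fin n, g j s ≠ 0
    · obtain ⟨j, hj⟩ := h
      rw [heval n l j s hj, Real.norm_eq_abs, abs_mul]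
      exact (mul_le_of_le_one_right (abs_nonneg _) (hle j s)).trans
        (le_ciSup (f := fun i => |l i|) (Set.finite_range _).bddAbove j)
    · push Not at h
      simpa [ContinuousMap.sum_apply, h] using hnn

/-- Along a subsequence, finitely many functions each either tend to zero or stay bounded away
from zero at the points `t n`, and a finite set of points avoids the disjoint sets `V n`. -/
theorem exists_subseq_tendsto_zero_or_bounded_below {K : Type*} [TopologicalSpace K]
    [CompactSpace K] (V : ℕ → Set K) (hVdisj : Pairwise fun n m => Disjoint (V n) (V m))
    (t : ℕ → K) {m : ℕ} (x : Fin m → C(K, ℝ)) (s : Fin m → K) :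
    ∃ φ : ℕ → ℕ, StrictMono φ ∧ (∀ i n, s i ∉ V (φ n)) ∧
      ∀ i, Tendsto (fun n => x i (t (φ n))) atTop (𝓝 0) ∨
        ∃ c > 0, ∀ n, c ≤ |x i (t (φ n))| := by
  have havoid : ∀ i, ∀ᶠ n in atTop, s i ∉ V n := by
    intro i
    by_cases h : ∃ k, s i ∈ V k
    · obtain ⟨k, hk⟩ := h
      filter_upwards [eventually_gt_atTop k] with n hn hsn
      exact Set.disjoint_left.1 (hVdisj hn.ne) hk hsn
    · push Not at h
      exact Eventually.of_forall h
  have hcpt : IsCompact (Set.range fun (p : K) (i : Fin m) => x i p) :=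
    isCompact_range (by fun_prop)
  obtain ⟨d, -, φ, hφ, hlim⟩ :=
    hcpt.tendsto_subseq (x := fun n i => x i (t n)) fun n => ⟨t n, rfl⟩
  have hlim' : ∀ i, Tendsto (fun n => x i (t (φ n))) atTop (𝓝 (d i)) := tendsto_pi_nhds.1 hlim
  have hbelow : ∀ i, ∀ᶠ n in atTop, d i ≠ 0 → |d i| / 2 ≤ |x i (t (φ n))| := by
    intro i
    by_cases hd : d i = 0
    · simp [hd]
    · have : |d i| / 2 < |d i| := half_lt_self (abs_pos.2 hd)
      filter_upwards [(hlim' i).abs.eventually_const_lt this] with n hn _ using hn.le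
  obtain ⟨N, hN⟩ := eventually_atTop.1
    ((eventually_all.2 fun i => hφ.tendsto_atTop.eventually (havoid i)).and
      (eventually_all.2 hbelow))
  refine ⟨fun n => φ (n + N), fun a b hab => hφ (by lia), fun i n => (hN _ (by lia)).1 i,
    fun i => ?_⟩
  by_cases hd : d i = 0
  · left
    rw [← hd]
    exact (hlim' i).comp (tendsto_add_atTop_nat N)
  · exact Or.inr ⟨|d i| / 2, half_pos (abs_pos.2 hd), fun n => (hN _ (by lia)).2 i hd⟩

/-- In a compact Hausdorff space, every open neighbourhood of a point carries a bump function
at this point. -/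
theorem exists_bump {K : Type*} [TopologicalSpace K] [CompactSpace K] [T2Space K]
    {U : Set K} (hU : IsOpen U) {p : K} (hp : p ∈ U) :
    ∃ f : C(K, ℝ), f p = 1 ∧ (∀ q ∉ U, f q = 0) ∧ ∀ q, 0 ≤ f q ∧ f q ≤ 1 := by
  obtain ⟨f, h0, h1, h⟩ := exists_continuous_zero_one_of_isClosed hU.isClosed_compl
    (isClosed_singleton (x := p)) (Set.disjoint_singleton_right.2 fun h => h hp)
  exact ⟨f, h1 rfl, fun q hq => h0 hq, h⟩

/-- A continuous function bounded by one that has modulus one somewhere has norm one. -/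
theorem norm_eq_one_of_le_of_abs_eq {K : Type*} [TopologicalSpace K] [CompactSpace K]
    {f : C(K, ℝ)} (hle : ∀ q, |f q| ≤ 1) {p : K} (hp : |f p| = 1) : ‖f‖ = 1 :=
  le_antisymm ((ContinuousMap.norm_le _ zero_le_one).2 hle)
    (hp ▸ ContinuousMap.norm_coe_le_norm f p)

/-- If `K` is an infinite compact Hausdorff space with a sequence of pairwise disjoint
nonempty open sets `Vₙ` with points `tₙ ∈ Vₙ`, then `C(K)` has the sequential SD2P. -/
theorem stmt16 {K : Type*} [TopologicalSpace K] [CompactSpace K] [T2Space K]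
    [Infinite K]
    (V : ℕ → Set K) (hVopen : ∀ n, IsOpen (V n))
    (hVne : ∀ n, (V n).Nonempty)
    (hVdisj : Pairwise fun n m => Disjoint (V n) (V m))
    (t : ℕ → K) (ht : ∀ n, t n ∈ V n) :
    SeqSD2P C(K, ℝ) := by
  intro m x hx
  have hx1 : ∀ i q, |x i q| ≤ 1 := fun i q => hx i ▸ ContinuousMap.norm_coe_le_norm (x i) q
  have hatt : ∀ i, ∃ s, |x i s| = 1 := by
    intro i
    obtain ⟨s, -, hs⟩ := isCompact_univ.exists_isMaxOn Set.univ_nonempty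
      (f := fun q => |x i q|) (by fun_prop)
    refine ⟨s, le_antisymm (hx1 i s) ?_⟩
    rw [← hx i, ContinuousMap.norm_le _ (abs_nonneg _)]
    exact fun q => hs (Set.mem_univ q)
  choose s hs using hatt
  obtain ⟨φ, hφ, hsV, hφx⟩ := exists_subseq_tendsto_zero_or_bounded_below V hVdisj t x s
  let U : ℕ → Set K := fun n =>
    V (φ n) ∩ ⋂ i, {q | |x i q - x i (t (φ n))| < 1 / ((n : ℝ) + 1)}
  have hUopen : ∀ n, IsOpen (U n) := fun n => (hVopen _).inter <|
    isOpen_iInter_of_finite fun i => isOpen_lt (by fun_prop) continuous_const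
  have htU : ∀ n, t (φ n) ∈ U n := fun n => ⟨ht _, Set.mem_iInter.2 fun i => by
    simp only [Set.mem_ofPred_eq, sub_self, abs_zero]; positivity⟩
  choose f hf1 hf0 hf using fun n => exists_bump (hUopen n) (htU n)
  have hfV : ∀ n, ∀ q ∉ V (φ n), f n q = 0 := fun n q hq => hf0 n q fun h => hq h.1
  have hfdisj : ∀ n k, n ≠ k → ∀ q, f n q = 0 ∨ f k q = 0 := by
    intro n k hnk q
    by_cases hq : q ∈ V (φ n)
    · exact Or.inr (hfV k q (Set.disjoint_left.1 (hVdisj (hφ.injective.ne hnk)) hq))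
    · exact Or.inl (hfV n q hq)
  have hfabs : ∀ n q, |f n q| ≤ 1 := fun n q => abs_le.2 ⟨by linarith [(hf n q).1], (hf n q).2⟩
  have hyabs : ∀ i n q, |(x i - x i * f n) q| ≤ 1 - f n q := by
    intro i n q
    have h : (x i - x i * f n) q = x i q * (1 - f n q) := by simp; ring
    have h' : 0 ≤ 1 - f n q := sub_nonneg.2 (hf n q).2
    rw [h, abs_mul, abs_of_nonneg h']
    exact mul_le_of_le_one_left h' (hx1 i q)
  refine ⟨fun i n => x i - x i * f n, f, fun i n => ?_, fun n => ?_, fun i => ?_, ?_, fun i => ?_⟩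
  · refine norm_eq_one_of_le_of_abs_eq (p := s i)
      (fun q => (hyabs i n q).trans (by linarith [(hf n q).1])) ?_
    simp [hfV n _ (hsV i n), hs i]
  · exact norm_eq_one_of_le_of_abs_eq (hfabs n) (p := t (φ n)) (by simp [hf1])
  · simp only [sub_sub_cancel]
    refine (hφx i).imp (fun hlim => ?_) fun ⟨c, hc, hbelow⟩ => ?_
    · have hbound : Tendsto (fun n : ℕ => |x i (t (φ n))| + 1 / ((n : ℝ) + 1)) atTop (𝓝 0) := by
        simpa using hlim.abs.add tendsto_one_div_add_atTop_nhds_zero_nat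
      refine squeeze_zero (fun n => norm_nonneg _) (fun n => ?_) hbound
      rw [ContinuousMap.norm_le _ (by positivity)]
      intro q
      by_cases hq : q ∈ U n
      · have hq' : |x i q - x i (t (φ n))| < 1 / ((n : ℝ) + 1) := Set.mem_iInter.1 hq.2 i
        have hmul : |x i q * f n q| ≤ |x i q| := by
          rw [abs_mul]; exact mul_le_of_le_one_right (abs_nonneg _) (hfabs n q)
        have htri := abs_sub_abs_le_abs_sub (x i q) (x i (t (φ n)))
        rw [ContinuousMap.mul_apply, Real.norm_eq_abs]
        linarith
      · rw [ContinuousMap.mul_apply, hf0 n q hq, mul_zero, norm_zero]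
        positivity
    · refine isEquivC0Basis_of_disjoint_support _ (fun n k hnk q => ?_) (fun n q => ?_)
        (fun n => t (φ n)) hc fun n => ?_
      · exact (hfdisj n k hnk q).imp (fun h => by simp [h]) fun h => by simp [h]
      · rw [ContinuousMap.mul_apply, abs_mul]
        exact mul_le_one₀ (hx1 i q) (abs_nonneg _) (hfabs n q)
      · simpa [hf1] using hbelow n
  · exact isEquivC0Basis_of_disjoint_support f hfdisj hfabs (fun n => t (φ n)) one_pos
      fun n => by simp [hf1]
  · have hadd : ∀ n, ‖x i - x i * f n + f n‖ = 1 := fun n =>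
      norm_eq_one_of_le_of_abs_eq (p := t (φ n)) (fun q => by
        have h := abs_le.1 (hyabs i n q)
        have hq := hf n q
        rw [ContinuousMap.add_apply, abs_le]
        constructor <;> linarith) (by simp [hf1])
    have hsub : ∀ n, ‖x i - x i * f n - f n‖ = 1 := fun n =>
      norm_eq_one_of_le_of_abs_eq (p := t (φ n)) (fun q => by
        have h := abs_le.1 (hyabs i n q)
        have hq := hf n q
        rw [ContinuousMap.sub_apply _ (f n), abs_le]
        constructor <;> linarith) (by simp [hf1])
    simp only [hadd, hsub]
    exact ⟨tendsto_const_nhds, tendsto_const_nhds⟩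
end
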